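/- arXiv:1403.1785 — 2 statements merged into one kernel-verified Lean document; each statement's English description precedes it below -/
import Mathlib

section
/- Let l > 0. For every Schwartz function φ on ℝ^4 one has −(1/16) ∫_{ℝ^4} |x|^{−2} log(|x|/l) Δ²( |x|² φ(x) ) dx + (5π²/16) [Δ(|·|² φ)](0) = −(1/2) ∫_{ℝ^4} |x|^{−2} log(|x|/l) (Δφ)(x) dx + π² φ(0), where [Δ(|·|² φ)](0) = 8 φ(0). (This is the algebra property r² R_4[r^{−6}] = R_4[r^{−4}] for the renormalized distributions R_4[r^{−6}] = −(1/16)Δ²(r^{−2} log(r/l)) + (5π²/16)Δδ and R_4[r^{−4}] = −(1/2)Δ(r^{−2} log(r/l)) + π²δ.) -/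
open MeasureTheory Real SchwartzMap

noncomputable section

/-- The Laplacian of a function on `ℝ^4`. -/
def lapl4 (f : EuclideanSpace ℝ (Fin 4) → ℝ) (x : EuclideanSpace ℝ (Fin 4)) : ℝ :=
  ∑ i : Fin 4,
    fderiv ℝ (fun y => fderiv ℝ f y (EuclideanSpace.single i 1)) x (EuclideanSpace.single i 1)

abbrev E4 := EuclideanSpace ℝ (Fin 4)

/-- basis vectors -/
abbrev ee (i : Fin 4) : E4 := EuclideanSpace.single i 1

/-- partial derivative on Schwartz space -/
def pd (i : Fin 4) (f : 𝓢(E4, ℝ)) : 𝓢(E4, ℝ) := LineDeriv.lineDerivOp (ee i) f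

theorem coord_tg (j : Fin 4) : Function.HasTemperateGrowth (fun x : E4 => x j) :=
  (EuclideanSpace.proj j : E4 →L[ℝ] ℝ).hasTemperateGrowth

/-- multiplication by a coordinate -/
def mx (j : Fin 4) (f : 𝓢(E4, ℝ)) : 𝓢(E4, ℝ) := smulLeftCLM ℝ (fun x : E4 => x j) f

theorem mx_apply (j : Fin 4) (f : 𝓢(E4, ℝ)) (x : E4) : mx j f x = x j * f x := by
  simp [mx, coord_tg j]

theorem pd_apply (j : Fin 4) (f : 𝓢(E4, ℝ)) (x : E4) : pd j f x = fderiv ℝ f x (ee j) :=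
  SchwartzMap.lineDerivOp_apply_eq_fderiv _ _ _

theorem pd_line (j : Fin 4) (f : 𝓢(E4, ℝ)) (x : E4) : HasLineDerivAt ℝ f (pd j f x) x (ee j) := by
  rw [pd_apply]
  exact (f.differentiable x).hasFDerivAt.hasLineDerivAt _

theorem pd_add (j : Fin 4) (f g : 𝓢(E4, ℝ)) : pd j (f + g) = pd j f + pd j g :=
  LineDeriv.lineDerivOp_add _ _ _

theorem pd_smul (j : Fin 4) (c : ℝ) (g : 𝓢(E4, ℝ)) : pd j (c • g) = c • pd j g :=
  LineDeriv.lineDerivOp_smul _ _ _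

/-- Laplacian on Schwartz space -/
def Lap (f : 𝓢(E4, ℝ)) : 𝓢(E4, ℝ) := ∑ i, pd i (pd i f)

theorem lapl4_eq (f : 𝓢(E4, ℝ)) : lapl4 f = Lap f := by
  funext x
  simp only [lapl4, Lap, _root_.sum_apply]
  refine Finset.sum_congr rfl fun i _ => ?_
  rw [pd_apply]
  congr 2

theorem coord_line (i j : Fin 4) (x : E4) :
    HasLineDerivAt ℝ (fun y : E4 => y j) (if i = j then 1 else 0) x (ee i) := by
  have h := (EuclideanSpace.proj j : E4 →L[ℝ] ℝ).hasFDerivAt (x := x)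
  have := h.hasLineDerivAt (ee i)
  have h2 : (EuclideanSpace.proj j : E4 →L[ℝ] ℝ) (ee i) = if i = j then 1 else 0 := by
    simp [ee, Pi.single_apply, eq_comm]
  rw [h2] at this
  exact this

theorem line_mul {f g : E4 → ℝ} {f' g' : ℝ} {x v : E4} (hf : HasLineDerivAt ℝ f f' x v)
    (hg : HasLineDerivAt ℝ g g' x v) :
    HasLineDerivAt ℝ (fun y => f y * g y) (f' * g x + f x * g') x v := by
  have := HasDerivAt.mul hf hg
  simp only [zero_smul, add_zero] at this
  exact this

theorem pd_mx (i j : Fin 4) (f : 𝓢(E4, ℝ)) :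
    pd i (mx j f) = (if i = j then (1:ℝ) else 0) • f + mx j (pd i f) := by
  ext x
  have h1 := pd_line i (mx j f) x
  have h2 : HasLineDerivAt ℝ (fun y : E4 => y j * f y)
    ((if i = j then (1:ℝ) else 0) * f x + x j * pd i f x) x (ee i) := by
    exact line_mul (coord_line i j x) (pd_line i f x)
  have h3 : (⇑(mx j f)) = (fun y : E4 => y j * f y) := by funext y; exact mx_apply j f y
  rw [h3] at h1
  have := h1.lineDeriv.symm.trans h2.lineDeriv
  rw [this]
  simp only [_root_.add_apply, _root_.smul_apply, mx_apply, smul_eq_mul]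

/-- the function `r² f` -/
def mr (f : 𝓢(E4, ℝ)) : 𝓢(E4, ℝ) := ∑ j, mx j (mx j f)

theorem mr_apply (f : 𝓢(E4, ℝ)) (x : E4) : mr f x = ‖x‖ ^ 2 * f x := by
  simp only [mr, _root_.sum_apply, mx_apply, EuclideanSpace.real_norm_sq_eq, Finset.sum_mul]
  refine Finset.sum_congr rfl fun i _ => by ring

/-- the auxiliary functions -/
def chi (f : 𝓢(E4, ℝ)) (j : Fin 4) : 𝓢(E4, ℝ) := (4:ℝ) • pd j f + mx j (Lap f)

def psi (f : 𝓢(E4, ℝ)) : 𝓢(E4, ℝ) := ∑ j, mx j (chi f j)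

theorem mx_add (j : Fin 4) (f g : 𝓢(E4, ℝ)) : mx j (f + g) = mx j f + mx j g := map_add _ _ _
theorem mx_smul (j : Fin 4) (c : ℝ) (g : 𝓢(E4, ℝ)) : mx j (c • g) = c • mx j g := map_smul _ _ _

theorem Lap_add (f g : 𝓢(E4, ℝ)) : Lap (f + g) = Lap f + Lap g := by
  simp [Lap, pd_add, Finset.sum_add_distrib]
theorem Lap_smul (c : ℝ) (f : 𝓢(E4, ℝ)) : Lap (c • f) = c • Lap f := by
  simp [Lap, pd_smul, Finset.smul_sum]

theorem Lap_mr (f : 𝓢(E4, ℝ)) : Lap (mr f) = (8:ℝ) • f + psi f := by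
  ext x
  simp only [Lap, mr, psi, chi, Fin.sum_univ_four, pd_add, pd_mx, pd_smul, mx_add, mx_smul]
  simp only [_root_.add_apply, _root_.smul_apply, mx_apply, smul_eq_mul]
  simp
  ring

/-- continuous off the origin, of order `k` at the origin and rapidly decaying -/
def DD (k : ℝ) (f : E4 → ℝ) : Prop :=
  ContinuousOn f {0}ᶜ ∧ ∀ N : ℕ, ∃ C : ℝ, ∀ x : E4, x ≠ 0 → ‖x‖ ^ N * |f x| ≤ C * ‖x‖ ^ k

theorem DD_schwartz (f : 𝓢(E4, ℝ)) : DD 0 f := by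
  refine ⟨f.continuous.continuousOn, fun N => ?_⟩
  obtain ⟨C, hC⟩ := f.decay N 0
  refine ⟨C, fun x _ => ?_⟩
  simpa using hC.2 x

theorem DD_add {k : ℝ} {f g : E4 → ℝ} (hf : DD k f) (hg : DD k g) :
    DD k (fun x => f x + g x) := by
  refine ⟨hf.1.add hg.1, fun N => ?_⟩
  obtain ⟨C, hC⟩ := hf.2 N
  obtain ⟨C', hC'⟩ := hg.2 N
  refine ⟨C + C', fun x hx => ?_⟩
  have h1 := hC x hx
  have h2 := hC' x hx
  have h3 : ‖x‖ ^ N * |f x + g x| ≤ ‖x‖ ^ N * (|f x| + |g x|) := by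
    gcongr
    exact abs_add_le _ _
  nlinarith

theorem DD_mul {k a : ℝ} {f h : E4 → ℝ} (hf : DD k f) (hc : ContinuousOn h {0}ᶜ) (C : ℝ)
    (hb : ∀ x : E4, x ≠ 0 → |h x| ≤ C * ‖x‖ ^ a) : DD (k + a) (fun x => h x * f x) := by
  refine ⟨hc.mul hf.1, fun N => ?_⟩
  obtain ⟨C', hC⟩ := hf.2 N
  refine ⟨C * C', fun x hx => ?_⟩
  have hx' : 0 < ‖x‖ := norm_pos_iff.2 hx
  rw [abs_mul, Real.rpow_add hx']
  have := mul_le_mul (hb x hx) (hC x hx) (by positivity) ((abs_nonneg _).trans (hb x hx))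
  calc _ = |h x| * (‖x‖ ^ N * |f x|) := by ring
    _ ≤ _ := this
    _ = _ := by ring

theorem contOn_log (l : ℝ) (hl : 0 < l) : ContinuousOn (fun x : E4 => Real.log (‖x‖ / l)) {0}ᶜ := by
  refine ContinuousOn.log (by fun_prop) fun x hx => ?_
  have hx' : 0 < ‖x‖ := norm_pos_iff.2 hx
  positivity

theorem DD_log {k : ℝ} {f : E4 → ℝ} (l : ℝ) (hl : 0 < l) (a b : ℝ) (hf : DD k f) :
    DD (k - 1 / 2) (fun x => (a + b * Real.log (‖x‖ / l)) * f x) := by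
  refine ⟨((continuousOn_const).add (continuousOn_const.mul (contOn_log l hl))).mul hf.1,
    fun N => ?_⟩
  obtain ⟨C, hC⟩ := hf.2 N
  obtain ⟨C', hC'⟩ := hf.2 (N + 1)
  obtain ⟨K, hK0, hK⟩ : ∃ K : ℝ, 0 ≤ K ∧ ∀ t : ℝ, 0 < t →
      |a + b * Real.log (t / l)| ≤ K * ((1 + t) * t ^ (-(1/2) : ℝ)) := by
    refine ⟨|a| + |b| * |Real.log l| + |b| * 2, by positivity, fun t ht => ?_⟩
    have e1 : 1 ≤ (1 + t) * t ^ (-(1/2) : ℝ) := by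
      rw [Real.rpow_neg ht.le, ← Real.sqrt_eq_rpow, ← div_eq_mul_inv, one_le_div (by positivity)]
      nlinarith [Real.sq_sqrt ht.le, sq_nonneg (√t - 1)]
    have e2 : |Real.log t| ≤ 2 * ((1 + t) * t ^ (-(1/2) : ℝ)) := by
      rw [Real.rpow_neg ht.le, ← Real.sqrt_eq_rpow]
      set s := √t with hs
      have hs0 : 0 < s := Real.sqrt_pos.2 ht
      have hts : t = s ^ 2 := (Real.sq_sqrt ht.le).symm
      rw [hts, Real.log_pow]
      have l1 := Real.log_le_sub_one_of_pos hs0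
      have l2 := Real.log_le_sub_one_of_pos (inv_pos.2 hs0)
      rw [Real.log_inv] at l2
      have e3 : (1 + s ^ 2) * s⁻¹ = s⁻¹ + s := by field_simp
      have : 0 < s⁻¹ := inv_pos.2 hs0
      rw [e3, abs_le]
      push_cast
      constructor <;> linarith
    rw [Real.log_div ht.ne' hl.ne']
    set m := (1 + t) * t ^ (-(1/2) : ℝ)
    calc |a + b * (Real.log t - Real.log l)| ≤ |a| + |b * (Real.log t - Real.log l)| := abs_add_le _ _
      _ ≤ |a| + |b| * (|Real.log t| + |Real.log l|) := by
        rw [abs_mul]; gcongr; exact abs_sub _ _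
      _ ≤ |a| * m + |b| * (2 * m + |Real.log l| * m) := by
        gcongr
        · exact le_mul_of_one_le_right (abs_nonneg _) e1
        · exact le_mul_of_one_le_right (abs_nonneg _) e1
      _ = _ := by ring
  refine ⟨K * (C + C'), fun x hx => ?_⟩
  have hx' : 0 < ‖x‖ := norm_pos_iff.2 hx
  have hp : 0 < ‖x‖ ^ (-(1/2) : ℝ) := Real.rpow_pos_of_pos hx' _
  rw [abs_mul, sub_eq_add_neg, Real.rpow_add hx']
  have h1 := hC x hx
  have h2 := hC' x hx
  calc ‖x‖ ^ N * (|a + b * Real.log (‖x‖ / l)| * |f x|)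
      ≤ ‖x‖ ^ N * ((K * ((1 + ‖x‖) * ‖x‖ ^ (-(1/2) : ℝ))) * |f x|) := by
        gcongr
        exact hK _ hx'
    _ = K * ‖x‖ ^ (-(1/2) : ℝ) * (‖x‖ ^ N * |f x| + ‖x‖ ^ (N + 1) * |f x|) := by ring
    _ ≤ K * ‖x‖ ^ (-(1/2) : ℝ) * (C * ‖x‖ ^ k + C' * ‖x‖ ^ k) := by gcongr
    _ = _ := by ring

theorem ae_ne_zero : ∀ᵐ x : E4, x ≠ 0 := by
  have : ({0}ᶜ : Set E4) ∈ ae (volume : Measure E4) := compl_mem_ae_iff.2 (measure_singleton 0)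
  exact this

theorem aesm_of_contOn {f : E4 → ℝ} (hf : ContinuousOn f {0}ᶜ) : AEStronglyMeasurable f volume := by
  have h := hf.aestronglyMeasurable (μ := volume) (measurableSet_singleton (0 : E4)).compl
  rwa [restrict_compl_singleton] at h

theorem DD_int {k : ℝ} {f : E4 → ℝ} (hf : DD k f) (hk : -4 < k) : Integrable f := by
  obtain ⟨N, hN⟩ := exists_nat_gt (k + 4)
  obtain ⟨C, hC⟩ := hf.2 0
  obtain ⟨C', hC'⟩ := hf.2 N
  set b : ℝ → ℝ := fun r => if r ≤ 1 then C * r ^ k else C' * r ^ (k - N) with hb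
  have hbi : Integrable (fun x : E4 => b ‖x‖) := by
    rw [integrable_fun_norm_addHaar (volume : Measure E4)]
    have h1 : IntegrableOn (fun y : ℝ => y ^ (Module.finrank ℝ E4 - 1) • b y) (Set.Ioc 0 1) := by
      have := (intervalIntegral.intervalIntegrable_rpow' (a := 0) (b := 1) (r := k + 3) (by linarith)).1
      refine IntegrableOn.congr_fun (this.const_mul C) (fun y hy => ?_) measurableSet_Ioc
      have hy0 : 0 < y := hy.1
      simp only [hb, if_pos hy.2, finrank_euclideanSpace_fin, smul_eq_mul]
      rw [Real.rpow_add hy0]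
      norm_cast
      ring
    have h2 : IntegrableOn (fun y : ℝ => y ^ (Module.finrank ℝ E4 - 1) • b y) (Set.Ioi 1) := by
      have := integrableOn_Ioi_rpow_of_lt (a := k - N + 3) (by linarith) one_pos
      refine IntegrableOn.congr_fun (this.const_mul C') (fun y hy => ?_) measurableSet_Ioi
      have hy1 : 1 < y := hy
      have hy0 : 0 < y := by linarith
      simp only [hb, if_neg (not_le.2 hy1), finrank_euclideanSpace_fin, smul_eq_mul]
      rw [Real.rpow_add hy0]
      norm_cast
      ring
    rw [← Set.Ioc_union_Ioi_eq_Ioi (zero_le_one (α := ℝ))]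
    exact h1.union h2
  refine hbi.mono' (aesm_of_contOn hf.1) ?_
  filter_upwards [ae_ne_zero] with x hx
  have hx' : 0 < ‖x‖ := norm_pos_iff.2 hx
  rw [Real.norm_eq_abs]
  simp only [hb]
  split_ifs with h
  · simpa using hC x hx
  · rw [Real.rpow_sub hx', Real.rpow_natCast, ← mul_div_assoc, le_div_iff₀ (by positivity), mul_comm]
    exact hC' x hx

theorem ibp {f f' : E4 → ℝ} (i : Fin 4) (hd : ∀ x : E4, x ≠ 0 → HasLineDerivAt ℝ f (f' x) x (ee i))
    (h0 : Integrable f) (h1 : Integrable (fun x => ‖x‖⁻¹ * f x)) (h2 : Integrable f') :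
    ∫ x, f' x = 0 := by
  let b : ContDiffBump (0 : E4) := ⟨1, 2, one_pos, one_lt_two⟩
  have hbs : ContDiff ℝ 1 b := b.contDiff
  have hbd : Differentiable ℝ b := hbs.differentiable one_ne_zero
  have hbc : Continuous (fun y : E4 => fderiv ℝ b y (ee i)) :=
    (hbs.continuous_fderiv one_ne_zero).clm_apply continuous_const
  obtain ⟨K, hK⟩ : ∃ K : ℝ, ∀ y : E4, ‖‖y‖ * fderiv ℝ b y (ee i)‖ ≤ K := by
    refine HasCompactSupport.exists_bound_of_continuous ?_ (by fun_prop)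
    have h := b.hasCompactSupport.fderiv_apply (𝕜 := ℝ) (ee i)
    exact h.mul_left
  let g : ℕ → E4 → ℝ := fun n x => 1 - b (((n : ℝ) + 1) • x)
  let g' : ℕ → E4 → ℝ := fun n x => - (((n : ℝ) + 1) * fderiv ℝ b (((n : ℝ) + 1) • x) (ee i))
  have hgc : ∀ n, Continuous (g n) := fun n => by
    have := b.continuous
    fun_prop
  have hgc' : ∀ n, Continuous (g' n) := fun n => by
    have : Continuous (fun x : E4 => fderiv ℝ b (((n : ℝ) + 1) • x) (ee i)) :=
      hbc.comp (by fun_prop : Continuous (fun x : E4 => ((n : ℝ) + 1) • x))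
    fun_prop
  have hgd : ∀ n x, HasLineDerivAt ℝ (g n) (g' n x) x (ee i) := fun n x => by
    have e1 : HasFDerivAt (fun x : E4 => ((n : ℝ) + 1) • x)
      (((n : ℝ) + 1) • ContinuousLinearMap.id ℝ E4) x :=
      (((n : ℝ) + 1) • ContinuousLinearMap.id ℝ E4).hasFDerivAt
    have e2 := ((hbd (((n : ℝ) + 1) • x)).hasFDerivAt.comp x e1).const_sub 1
    have e3 := e2.hasLineDerivAt (ee i)
    simpa [g, g', Function.comp_def] using e3
  have hg1 : ∀ n x, ‖g n x‖ ≤ 1 := fun n x => by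
    have a1 := b.nonneg (x := ((n : ℝ) + 1) • x)
    have a2 := b.le_one (x := ((n : ℝ) + 1) • x)
    simp only [g, Real.norm_eq_abs, abs_le]
    constructor <;> linarith
  have hg2 : ∀ n x, x ≠ 0 → ‖g' n x‖ ≤ K * ‖x‖⁻¹ := fun n x hx => by
    have hx' : 0 < ‖x‖ := norm_pos_iff.2 hx
    rw [← div_eq_mul_inv, le_div_iff₀ hx']
    have := hK (((n : ℝ) + 1) • x)
    have hn : (0:ℝ) < (n : ℝ) + 1 := by positivity
    rw [norm_mul, norm_norm, norm_smul, Real.norm_of_nonneg hn.le] at this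
    simp only [g', norm_neg, norm_mul, Real.norm_of_nonneg hn.le]
    linarith
  have hev : ∀ x : E4, x ≠ 0 → ∀ᶠ n : ℕ in Filter.atTop, 2 < ‖((n : ℝ) + 1) • x‖ := fun x hx => by
    have hx' : 0 < ‖x‖ := norm_pos_iff.2 hx
    obtain ⟨M, hM⟩ := exists_nat_gt (2 / ‖x‖)
    filter_upwards [Filter.eventually_ge_atTop M] with n hn
    have hn' : (M : ℝ) ≤ n := by exact_mod_cast hn
    rw [norm_smul, Real.norm_of_nonneg (by positivity), ← div_lt_iff₀ hx']
    linarith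
  have hz : ∀ y : E4, 2 < ‖y‖ → b y = 0 ∧ fderiv ℝ b y = 0 := fun y hy => by
    have ht : y ∉ tsupport b := by
      rw [b.tsupport_eq]
      simpa [b] using hy
    exact ⟨image_eq_zero_of_notMem_tsupport ht,
      image_eq_zero_of_notMem_tsupport fun h => ht (tsupport_fderiv_subset ℝ h)⟩
  have hsup : ∀ n, ∀ x ∈ tsupport (g n), x ≠ 0 := by
    rintro n x hx rfl
    refine notMem_tsupport_iff_eventuallyEq.2 ?_ hx
    have e1 : ∀ᶠ y in nhds (0 : E4), b y = 1 := b.eventuallyEq_one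
    have e2 : Filter.Tendsto (fun x : E4 => ((n : ℝ) + 1) • x) (nhds 0) (nhds 0) := by
      have : Continuous (fun x : E4 => ((n : ℝ) + 1) • x) := by fun_prop
      simpa using this.tendsto 0
    filter_upwards [e2.eventually e1] with y hy
    simp [g, hy]
  have I1 : ∀ n, Integrable (fun x => f' x * g n x) := fun n =>
    h2.mul_bdd (c := 1) (hgc n).aestronglyMeasurable (Filter.Eventually.of_forall (hg1 n))
  have I3 : ∀ n, Integrable (fun x => f x * g n x) := fun n =>
    h0.mul_bdd (c := 1) (hgc n).aestronglyMeasurable (Filter.Eventually.of_forall (hg1 n))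
  have B2 : ∀ n, ∀ᵐ x : E4, ‖f x * g' n x‖ ≤ K * ‖‖x‖⁻¹ * f x‖ := fun n => by
    filter_upwards [ae_ne_zero] with x hx
    have := hg2 n x hx
    rw [norm_mul, norm_mul, norm_inv, norm_norm]
    calc _ ≤ ‖f x‖ * (K * ‖x‖⁻¹) := by gcongr
      _ = _ := by ring
  have I2 : ∀ n, Integrable (fun x => f x * g' n x) := fun n =>
    (h1.norm.const_mul K).mono' (h0.aestronglyMeasurable.mul (hgc' n).aestronglyMeasurable) (B2 n)
  have key : ∀ n, ∫ x, f x * g' n x = - ∫ x, f' x * g n x := fun n =>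
    integral_bilinear_hasLineDerivAt_right_eq_neg_left_of_integrable (μ := volume)
      (B := ContinuousLinearMap.mul ℝ ℝ) (v := ee i) (I1 n) (I2 n) (I3 n)
      (fun x hx => hd x (hsup n x hx)) (fun x _ => hgd n x)
  have L1 : Filter.Tendsto (fun n => ∫ x, f' x * g n x) Filter.atTop (nhds (∫ x, f' x)) := by
    refine tendsto_integral_of_dominated_convergence (fun x => ‖f' x‖)
      (fun n => (I1 n).aestronglyMeasurable) h2.norm (fun n => ?_) ?_
    · refine Filter.Eventually.of_forall fun x => ?_
      rw [norm_mul]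
      exact mul_le_of_le_one_right (norm_nonneg _) (hg1 n x)
    · filter_upwards [ae_ne_zero] with x hx
      refine tendsto_const_nhds.congr' ?_
      filter_upwards [hev x hx] with n hn
      simp [g, (hz _ hn).1]
  have L2 : Filter.Tendsto (fun n => ∫ x, f x * g' n x) Filter.atTop (nhds (∫ _ : E4, (0 : ℝ))) := by
    refine tendsto_integral_of_dominated_convergence (fun x => K * ‖‖x‖⁻¹ * f x‖)
      (fun n => (I2 n).aestronglyMeasurable) (h1.norm.const_mul K) B2 ?_
    filter_upwards [ae_ne_zero] with x hx
    refine tendsto_const_nhds.congr' ?_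
    filter_upwards [hev x hx] with n hn
    simp [g', (hz _ hn).2]
  have L3 := L1.neg
  simp only [← key] at L3
  have := tendsto_nhds_unique L2 L3
  simp at this
  linarith

/-- the Euler derivative -/
def eul (φ : 𝓢(E4, ℝ)) (x : E4) : ℝ := ∑ j, x j * pd j φ x

theorem eul_eq (φ : 𝓢(E4, ℝ)) (x : E4) : eul φ x = fderiv ℝ φ x x := by
  have hx : x = ∑ j, x j • ee j := by
    ext k
    simp [ee, Pi.single_apply]
  conv_rhs => rw [hx, map_sum]
  simp only [map_smul, smul_eq_mul, eul, pd_apply]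
  rw [← hx]

theorem DD_inv {k : ℝ} {f : E4 → ℝ} (hf : DD k f) : DD (k - 1) (fun x => ‖x‖⁻¹ * f x) := by
  refine DD_mul (a := -1) hf ?_ 1 fun x hx => ?_
  · exact continuousOn_id.norm.inv₀ fun x hx => norm_ne_zero_iff.2 hx
  · rw [Real.rpow_neg_one, abs_of_nonneg (by positivity), one_mul]

theorem DD_inv2 {k : ℝ} {f : E4 → ℝ} (hf : DD k f) : DD (k - 2) (fun x => (‖x‖ ^ 2)⁻¹ * f x) := by
  have h := DD_inv (DD_inv hf)
  have e : (fun x : E4 => (‖x‖ ^ 2)⁻¹ * f x) = fun x => ‖x‖⁻¹ * (‖x‖⁻¹ * f x) := by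
    funext x; rw [pow_two, mul_inv]; ring
  rw [e, show k - 2 = k - 1 - 1 by ring]
  exact h

theorem DD_coord {k : ℝ} {f : E4 → ℝ} (j : Fin 4) (hf : DD k f) : DD (k + 1) (fun x => x j * f x) := by
  refine DD_mul (a := 1) hf (by fun_prop) 1 fun x hx => ?_
  rw [Real.rpow_one, one_mul]
  exact PiLp.norm_apply_le x j

theorem DD_sum4 {k : ℝ} {f : Fin 4 → E4 → ℝ} (hf : ∀ i, DD k (f i)) : DD k (fun x => ∑ i, f i x) := by
  simp only [Fin.sum_univ_four]
  exact DD_add (DD_add (DD_add (hf 0) (hf 1)) (hf 2)) (hf 3)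

theorem DD_eul (φ : 𝓢(E4, ℝ)) : DD (0 + 1) (eul φ) :=
  DD_sum4 fun j => DD_coord j (DD_schwartz (pd j φ))

theorem polar (f : E4 → ℝ) (hf : Integrable f) :
    ∫ x, f x = ∫ w : Metric.sphere (0 : E4) 1, (∫ r in Set.Ioi (0:ℝ), r ^ 3 * f (r • (w : E4)))
      ∂(volume : Measure E4).toSphere := by
  have hmp := (volume : Measure E4).measurePreserving_homeomorphUnitSphereProd
  have hemb := (homeomorphUnitSphereProd E4).measurableEmbedding
  let F : Metric.sphere (0 : E4) 1 × Set.Ioi (0:ℝ) → ℝ := fun p => f ((p.2 : ℝ) • (p.1 : E4))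
  have hF : ∀ x : ({0}ᶜ : Set E4), F (homeomorphUnitSphereProd E4 x) = f x := fun x => by
    have hx : (x : E4) ≠ 0 := x.2
    simp only [F]
    congr 1
    simp [smul_smul, hx]
  have e1 : ∫ x, f x = ∫ x : ({0}ᶜ : Set E4), f x ∂(Measure.comap (↑) (volume : Measure E4)) := by
    rw [integral_subtype_comap (measurableSet_singleton _).compl f, restrict_compl_singleton]
  have e2 := hmp.integral_comp hemb F
  simp only [hF] at e2
  have i1 : Integrable (fun x : ({0}ᶜ : Set E4) => f x) (Measure.comap (↑) (volume : Measure E4)) := by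
    have : IntegrableOn f ({0}ᶜ : Set E4) := hf.integrableOn
    rwa [integrableOn_iff_comap_subtypeVal (measurableSet_singleton _).compl] at this
  have i2 := (hmp.integrable_comp_emb (g := F) hemb)
  have i3 : Integrable F ((volume : Measure E4).toSphere.prod
      (Measure.volumeIoiPow (Module.finrank ℝ E4 - 1))) := by
    rw [← i2]
    convert i1 using 2 with x
    exact hF x
  rw [e1, e2, integral_prod _ i3]
  congr 1
  funext w
  simp only [F, Measure.volumeIoiPow, finrank_euclideanSpace_fin, ENNReal.ofReal]
  rw [integral_withDensity_eq_integral_smul (by fun_prop),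
    integral_subtype_comap measurableSet_Ioi
      (fun r : ℝ => Real.toNNReal (r ^ (4 - 1)) • f (r • (w : E4)))]
  refine setIntegral_congr_fun measurableSet_Ioi fun r hr => ?_
  have hr0 : 0 < r := hr
  simp only [NNReal.smul_def, smul_eq_mul]
  rw [Real.coe_toNNReal _ (by positivity)]

theorem int_eul (φ : 𝓢(E4, ℝ)) :
    Integrable (fun x => (‖x‖ ^ 2)⁻¹ * ((‖x‖ ^ 2)⁻¹ * eul φ x)) :=
  DD_int (DD_inv2 (DD_inv2 (DD_eul φ))) (by norm_num)

theorem integral_eul (φ : 𝓢(E4, ℝ)) :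
    ∫ x, (‖x‖ ^ 2)⁻¹ * ((‖x‖ ^ 2)⁻¹ * eul φ x) = - (2 * π ^ 2 * φ 0) := by
  rw [polar _ (int_eul φ)]
  have key : ∀ w : Metric.sphere (0 : E4) 1, (∫ r in Set.Ioi (0:ℝ), r ^ 3 *
      ((‖r • (w : E4)‖ ^ 2)⁻¹ * ((‖r • (w : E4)‖ ^ 2)⁻¹ * eul φ (r • (w : E4))))) = - φ 0 := by
    intro w
    have hw : ‖(w : E4)‖ = 1 := by simpa using w.2
    have e : ∫ r in Set.Ioi (0:ℝ), r ^ 3 *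
      ((‖r • (w : E4)‖ ^ 2)⁻¹ * ((‖r • (w : E4)‖ ^ 2)⁻¹ * eul φ (r • (w : E4)))) =
      ∫ r in Set.Ioi (0:ℝ), fderiv ℝ φ (r • (w : E4)) w := by
      refine setIntegral_congr_fun measurableSet_Ioi fun r hr => ?_
      have hr0 : 0 < r := hr
      simp only [eul_eq, norm_smul, hw, Real.norm_of_nonneg hr0.le, map_smul, smul_eq_mul]
      field_simp
    rw [e]
    have hder : ∀ r : ℝ, HasDerivAt (fun r : ℝ => φ (r • (w : E4))) (fderiv ℝ φ (r • (w : E4)) w) r := by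
      intro r
      have h1 := (φ.differentiable (r • (w : E4))).hasFDerivAt
      have h2 : HasDerivAt (fun r : ℝ => r • (w : E4)) (w : E4) r := by
        simpa using (hasDerivAt_id r).smul_const (w : E4)
      exact h1.comp_hasDerivAt r h2
    have hcont : Continuous (fun r : ℝ => fderiv ℝ φ (r • (w : E4)) w) := by
      have h1 : Continuous (fderiv ℝ φ) := (φ.smooth 1).continuous_fderiv one_ne_zero
      have h2 : Continuous (fun r : ℝ => fderiv ℝ φ (r • (w : E4))) := h1.comp (by fun_prop)
      exact h2.clm_apply continuous_const
    obtain ⟨C, hC0, hC⟩ := φ.decay 2 1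
    obtain ⟨C2, hC20, hC2⟩ := φ.decay 1 0
    have hint : IntegrableOn (fun r : ℝ => fderiv ℝ φ (r • (w : E4)) w) (Set.Ioi 0) := by
      rw [← Set.Ioc_union_Ioi_eq_Ioi (zero_le_one (α := ℝ))]
      refine IntegrableOn.union (hcont.integrableOn_Ioc) ?_
      have hp := integrableOn_Ioi_rpow_of_lt (a := -2) (by norm_num) one_pos
      refine (hp.const_mul C).mono' hcont.aestronglyMeasurable ?_
      filter_upwards [ae_restrict_mem measurableSet_Ioi] with r hr
      have hr1 : 1 < r := hr
      have hr0 : 0 < r := by linarith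
      have h1 := hC (r • (w : E4))
      rw [norm_smul, hw, Real.norm_of_nonneg hr0.le, mul_one, norm_iteratedFDeriv_one] at h1
      have h2 := (fderiv ℝ φ (r • (w : E4))).le_opNorm w
      rw [hw, mul_one] at h2
      rw [Real.rpow_neg hr0.le, ← div_eq_mul_inv, le_div_iff₀ (by positivity)]
      norm_cast
      nlinarith [sq_nonneg r]
    have hlim : Filter.Tendsto (fun r : ℝ => φ (r • (w : E4))) Filter.atTop (nhds 0) := by
      have hz : Filter.Tendsto (fun r : ℝ => C2 / r) Filter.atTop (nhds 0) :=
        tendsto_const_nhds.div_atTop Filter.tendsto_id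
      refine squeeze_zero_norm' ?_ hz
      filter_upwards [Filter.eventually_gt_atTop 0] with r hr0
      have h1 := hC2 (r • (w : E4))
      rw [norm_smul, hw, Real.norm_of_nonneg hr0.le, mul_one, norm_iteratedFDeriv_zero, pow_one] at h1
      rw [le_div_iff₀ hr0]
      linarith
    have := integral_Ioi_of_hasDerivAt_of_tendsto' (a := 0) (fun r _ => hder r) hint hlim
    rw [this]
    simp
  simp only [key]
  rw [integral_const, Measure.toSphere_real_apply_univ, measureReal_def,
    InnerProductSpace.volume_ball_of_dim_even (k := 2) (by simp)]
  simp [ENNReal.toReal_ofReal, Nat.factorial]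
  ring_nf
  rw [ENNReal.toReal_ofReal (by positivity)]
  refine Or.inl ?_
  ring

theorem line_q (i : Fin 4) (x : E4) :
    HasLineDerivAt ℝ (fun y : E4 => ‖y‖ ^ 2) (2 * x i) x (ee i) := by
  have h := (hasStrictFDerivAt_norm_sq x).hasFDerivAt.hasLineDerivAt (ee i)
  have e : (2 • (innerSL ℝ x)) (ee i) = 2 * x i := by
    simp [ee, EuclideanSpace.inner_single_right]
  rw [e] at h
  exact h

theorem line_qinv (i : Fin 4) (x : E4) (hx : x ≠ 0) :
    HasLineDerivAt ℝ (fun y : E4 => (‖y‖ ^ 2)⁻¹) (-(2 * x i) * ((‖x‖ ^ 2)⁻¹ * (‖x‖ ^ 2)⁻¹)) x (ee i) := by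
  have hx' : ‖x‖ ≠ 0 := norm_ne_zero_iff.2 hx
  have h := HasDerivAt.fun_inv (line_q i x) (by simpa using hx')
  simp only [zero_smul, add_zero] at h
  have e : -(2 * x i) * ((‖x‖ ^ 2)⁻¹ * (‖x‖ ^ 2)⁻¹) = -(2 * x i) / (‖x‖ ^ 2) ^ 2 := by
    field_simp
  rw [e]
  exact h

theorem line_log (l : ℝ) (hl : 0 < l) (i : Fin 4) (x : E4) (hx : x ≠ 0) :
    HasLineDerivAt ℝ (fun y : E4 => Real.log (‖y‖ / l)) (x i * (‖x‖ ^ 2)⁻¹) x (ee i) := by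
  have hx' : 0 < ‖x‖ := norm_pos_iff.2 hx
  have h := ((HasDerivAt.sqrt (line_q i x) (by simpa using hx'.ne')).div_const l).log
    (by simp [hx, hl.ne'])
  simp only [zero_smul, add_zero, Real.sqrt_sq (norm_nonneg _)] at h
  have e : x i * (‖x‖ ^ 2)⁻¹ = 2 * x i / (2 * ‖x‖) / l / (‖x‖ / l) := by
    field_simp
  rw [e]
  exact h

/-- the kernel, and its first and second partial derivatives -/
def uu (l : ℝ) (x : E4) : ℝ := (‖x‖ ^ 2)⁻¹ * Real.log (‖x‖ / l)
def u1 (l : ℝ) (i : Fin 4) (x : E4) : ℝ :=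
  x i * ((‖x‖ ^ 2)⁻¹ * (‖x‖ ^ 2)⁻¹ * (1 + (-2) * Real.log (‖x‖ / l)))
def u2 (l : ℝ) (i : Fin 4) (x : E4) : ℝ :=
  (‖x‖ ^ 2)⁻¹ * (‖x‖ ^ 2)⁻¹ * (1 + (-2) * Real.log (‖x‖ / l)) +
    x i * (x i * ((‖x‖ ^ 2)⁻¹ * (‖x‖ ^ 2)⁻¹ * (‖x‖ ^ 2)⁻¹ * (-6 + 8 * Real.log (‖x‖ / l))))

theorem line_uu (l : ℝ) (hl : 0 < l) (i : Fin 4) (x : E4) (hx : x ≠ 0) :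
    HasLineDerivAt ℝ (uu l) (u1 l i x) x (ee i) := by
  have h := line_mul (line_qinv i x hx) (line_log l hl i x hx)
  have e : u1 l i x = -(2 * x i) * ((‖x‖ ^ 2)⁻¹ * (‖x‖ ^ 2)⁻¹) * Real.log (‖x‖ / l) +
    (‖x‖ ^ 2)⁻¹ * (x i * (‖x‖ ^ 2)⁻¹) := by
    simp only [u1]; ring
  rw [e]
  exact h

theorem line_u1 (l : ℝ) (hl : 0 < l) (i : Fin 4) (x : E4) (hx : x ≠ 0) :
    HasLineDerivAt ℝ (u1 l i) (u2 l i x) x (ee i) := by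
  have h1 : HasLineDerivAt ℝ (fun y : E4 => 1 + (-2) * Real.log (‖y‖ / l))
      ((-2) * (x i * (‖x‖ ^ 2)⁻¹)) x (ee i) :=
    (HasDerivAt.const_mul (-2) (line_log l hl i x hx)).const_add 1
  have h := line_mul (coord_line i i x)
    (line_mul (line_mul (line_qinv i x hx) (line_qinv i x hx)) h1)
  have hx' : ‖x‖ ≠ 0 := norm_ne_zero_iff.2 hx
  convert! h using 1
  simp only [u2, if_true]
  ring

theorem DD_uu (l : ℝ) (hl : 0 < l) {k : ℝ} {f : E4 → ℝ} (hf : DD k f) :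
    DD (k - 2 - 1 / 2) (fun x => uu l x * f x) := by
  convert DD_log l hl 0 1 (DD_inv2 hf) using 2 with x
  simp only [uu]; ring

theorem DD_u1 (l : ℝ) (hl : 0 < l) (i : Fin 4) {k : ℝ} {f : E4 → ℝ} (hf : DD k f) :
    DD (k - 2 - 2 + 1 - 1 / 2) (fun x => u1 l i x * f x) := by
  convert DD_log l hl 1 (-2) (DD_coord i (DD_inv2 (DD_inv2 hf))) using 2 with x
  simp only [u1]; ring

theorem DD_u2 (l : ℝ) (hl : 0 < l) (i : Fin 4) {k : ℝ} {f : E4 → ℝ} (hf : DD k f) :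
    DD (k - 2 - 2 - 1 / 2) (fun x => u2 l i x * f x) := by
  have h2 := DD_log l hl (-6) 8 (DD_coord i (DD_coord i (DD_inv2 (DD_inv2 (DD_inv2 hf)))))
  rw [show k - 2 - 2 - 2 + 1 + 1 - 1 / 2 = k - 2 - 2 - 1 / 2 by ring] at h2
  convert DD_add (DD_log l hl 1 (-2) (DD_inv2 (DD_inv2 hf))) h2 using 2 with x
  simp only [u2]; ring

theorem sum_u2 (l : ℝ) (x : E4) (hx : x ≠ 0) :
    ∑ i, u2 l i x = -2 * ((‖x‖ ^ 2)⁻¹ * (‖x‖ ^ 2)⁻¹) := by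
  have hx' : ‖x‖ ^ 2 ≠ 0 := pow_ne_zero 2 (norm_ne_zero_iff.2 hx)
  have hq : ∑ i, x i ^ 2 = ‖x‖ ^ 2 := (EuclideanSpace.real_norm_sq_eq x).symm
  simp only [Fin.sum_univ_four] at hq
  have e : ∑ i, u2 l i x = 4 * ((‖x‖ ^ 2)⁻¹ * (‖x‖ ^ 2)⁻¹ * (1 + (-2) * Real.log (‖x‖ / l))) +
     (x 0 ^ 2 + x 1 ^ 2 + x 2 ^ 2 + x 3 ^ 2) *
     ((‖x‖ ^ 2)⁻¹ * (‖x‖ ^ 2)⁻¹ * (‖x‖ ^ 2)⁻¹ * (-6 + 8 * Real.log (‖x‖ / l))) := by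
    simp only [u2, Fin.sum_univ_four]; ring
  rw [e, hq]
  field_simp
  ring

theorem green_one (l : ℝ) (hl : 0 < l) (i : Fin 4) (ψ : 𝓢(E4, ℝ)) (hψ : DD (0 + 1) ψ) :
    ∫ x, uu l x * pd i (pd i ψ) x = ∫ x, u2 l i x * ψ x := by
  have d0 := DD_schwartz (pd i ψ)
  have d1 := DD_schwartz (pd i (pd i ψ))
  have a1 := DD_int (DD_uu l hl d1) (by norm_num)
  have a2 := DD_int (DD_u1 l hl i d0) (by norm_num)
  have a3 := DD_int (DD_u2 l hl i hψ) (by norm_num)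
  have b1 := ibp (f := fun x => uu l x * pd i ψ x)
    (f' := fun x => u1 l i x * pd i ψ x + uu l x * pd i (pd i ψ) x) i
    (fun x hx => line_mul (line_uu l hl i x hx) (pd_line i (pd i ψ) x))
    (DD_int (DD_uu l hl d0) (by norm_num)) (DD_int (DD_inv (DD_uu l hl d0)) (by norm_num))
    (a2.add a1)
  have b2 := ibp (f := fun x => u1 l i x * ψ x)
    (f' := fun x => u2 l i x * ψ x + u1 l i x * pd i ψ x) i
    (fun x hx => line_mul (line_u1 l hl i x hx) (pd_line i ψ x))
    (DD_int (DD_u1 l hl i hψ) (by norm_num)) (DD_int (DD_inv (DD_u1 l hl i hψ)) (by norm_num))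
    (a3.add a2)
  rw [integral_add a2 a1] at b1
  rw [integral_add a3 a2] at b2
  linarith

theorem green (l : ℝ) (hl : 0 < l) (ψ : 𝓢(E4, ℝ)) (hψ : DD (0 + 1) ψ) :
    ∫ x, uu l x * Lap ψ x = -2 * ∫ x, (‖x‖ ^ 2)⁻¹ * ((‖x‖ ^ 2)⁻¹ * ψ x) := by
  have a1 : ∀ i, Integrable (fun x => uu l x * pd i (pd i ψ) x) := fun i =>
    DD_int (DD_uu l hl (DD_schwartz (pd i (pd i ψ)))) (by norm_num)
  have a3 : ∀ i, Integrable (fun x => u2 l i x * ψ x) := fun i =>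
    DD_int (DD_u2 l hl i hψ) (by norm_num)
  simp only [Lap, _root_.sum_apply, Finset.mul_sum]
  rw [integral_finsetSum _ fun i _ => a1 i]
  simp only [green_one l hl _ ψ hψ]
  rw [← integral_finsetSum _ fun i _ => a3 i, ← integral_const_mul]
  refine integral_congr_ae ?_
  filter_upwards [ae_ne_zero] with x hx
  rw [← Finset.sum_mul, sum_u2 l x hx]
  ring

theorem int_qLap (φ : 𝓢(E4, ℝ)) : Integrable (fun x => (‖x‖ ^ 2)⁻¹ * Lap φ x) :=
  DD_int (DD_inv2 (DD_schwartz (Lap φ))) (by norm_num)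

theorem newton (φ : 𝓢(E4, ℝ)) :
    ∫ x, (‖x‖ ^ 2)⁻¹ * Lap φ x = 2 * ∫ x, (‖x‖ ^ 2)⁻¹ * ((‖x‖ ^ 2)⁻¹ * eul φ x) := by
  have a1 : ∀ i, Integrable (fun x => (‖x‖ ^ 2)⁻¹ * pd i (pd i φ) x) := fun i =>
    DD_int (DD_inv2 (DD_schwartz (pd i (pd i φ)))) (by norm_num)
  have a2 : ∀ i : Fin 4, Integrable (fun x : E4 => x i * ((‖x‖ ^ 2)⁻¹ * ((‖x‖ ^ 2)⁻¹ * pd i φ x))) := fun i =>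
    DD_int (DD_coord i (DD_inv2 (DD_inv2 (DD_schwartz (pd i φ))))) (by norm_num)
  have key : ∀ i : Fin 4, ∫ x, (‖x‖ ^ 2)⁻¹ * pd i (pd i φ) x =
      2 * ∫ x : E4, x i * ((‖x‖ ^ 2)⁻¹ * ((‖x‖ ^ 2)⁻¹ * pd i φ x)) := fun i => by
    have b := ibp (f := fun x => (‖x‖ ^ 2)⁻¹ * pd i φ x)
      (f' := fun x => (-2) * (x i * ((‖x‖ ^ 2)⁻¹ * ((‖x‖ ^ 2)⁻¹ * pd i φ x))) +
        (‖x‖ ^ 2)⁻¹ * pd i (pd i φ) x) i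
      (fun x hx => by
        convert! line_mul (line_qinv i x hx) (pd_line i (pd i φ) x) using 1
        ring)
      (DD_int (DD_inv2 (DD_schwartz (pd i φ))) (by norm_num))
      (DD_int (DD_inv (DD_inv2 (DD_schwartz (pd i φ)))) (by norm_num))
      (((a2 i).const_mul (-2)).add (a1 i))
    rw [integral_add ((a2 i).const_mul (-2)) (a1 i), integral_const_mul] at b
    linarith
  simp only [Lap, _root_.sum_apply, Finset.mul_sum, eul]
  rw [integral_finsetSum _ fun i _ => a1 i]
  simp only [key]
  rw [← Finset.mul_sum, ← integral_finsetSum _ fun i _ => a2 i]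
  congr 1
  refine integral_congr_ae (Filter.Eventually.of_forall fun x => ?_)
  refine Finset.sum_congr rfl fun i _ => ?_
  ring

theorem DD_psi (φ : 𝓢(E4, ℝ)) : DD (0 + 1) (psi φ) := by
  have h : DD (0 + 1) (fun x : E4 => ∑ j, x j * chi φ j x) :=
    DD_sum4 fun j => DD_coord j (DD_schwartz (chi φ j))
  convert h using 2 with x
  simp only [psi, _root_.sum_apply, mx_apply]

theorem psi_apply (φ : 𝓢(E4, ℝ)) (x : E4) : psi φ x = 4 * eul φ x + ‖x‖ ^ 2 * Lap φ x := by
  simp only [psi, chi, eul, _root_.sum_apply, mx_apply, _root_.add_apply, _root_.smul_apply,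
    smul_eq_mul, EuclideanSpace.real_norm_sq_eq, Fin.sum_univ_four]
  ring

theorem int_uLap_psi (l : ℝ) (hl : 0 < l) (φ : 𝓢(E4, ℝ)) :
    ∫ x, uu l x * Lap (psi φ) x = 24 * π ^ 2 * φ 0 := by
  rw [green l hl _ (DD_psi φ)]
  have e : ∫ x, (‖x‖ ^ 2)⁻¹ * ((‖x‖ ^ 2)⁻¹ * psi φ x) =
      ∫ x, (4 * ((‖x‖ ^ 2)⁻¹ * ((‖x‖ ^ 2)⁻¹ * eul φ x)) + (‖x‖ ^ 2)⁻¹ * Lap φ x) := by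
    refine integral_congr_ae ?_
    filter_upwards [ae_ne_zero] with x hx
    have hx' : ‖x‖ ≠ 0 := norm_ne_zero_iff.2 hx
    rw [psi_apply]
    field_simp
  rw [e, integral_add ((int_eul φ).const_mul 4) (int_qLap φ), integral_const_mul, newton,
    integral_eul]
  ring

theorem stmt_6 (l : ℝ) (hl : 0 < l) (φ : SchwartzMap (EuclideanSpace ℝ (Fin 4)) ℝ) :
    lapl4 (fun y => ‖y‖ ^ 2 * φ y) 0 = 8 * φ 0 ∧
    -(1 / 16) * (∫ x : EuclideanSpace ℝ (Fin 4),
          ‖x‖ ^ (-(2 : ℝ)) * Real.log (‖x‖ / l) *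
            lapl4 (lapl4 (fun y => ‖y‖ ^ 2 * φ y)) x)
        + (5 * Real.pi ^ 2 / 16) * lapl4 (fun y => ‖y‖ ^ 2 * φ y) 0
      = -(1 / 2) * (∫ x : EuclideanSpace ℝ (Fin 4),
            ‖x‖ ^ (-(2 : ℝ)) * Real.log (‖x‖ / l) * lapl4 (⇑φ) x)
        + Real.pi ^ 2 * φ 0 := by
  have hmr : (fun y : E4 => ‖y‖ ^ 2 * φ y) = mr φ := by
    funext y; exact (mr_apply φ y).symm
  have hu : ∀ x : E4, ‖x‖ ^ (-(2 : ℝ)) * Real.log (‖x‖ / l) = uu l x := fun x => by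
    rw [uu, Real.rpow_neg (norm_nonneg _)]
    norm_cast
  have h0 : Lap (mr φ) 0 = 8 * φ 0 := by
    rw [Lap_mr]
    simp [psi_apply, eul]
  have hI : ∫ x, uu l x * Lap (Lap (mr φ)) x =
      8 * (∫ x, uu l x * Lap φ x) + 24 * π ^ 2 * φ 0 := by
    have a1 : Integrable (fun x => uu l x * Lap φ x) :=
      DD_int (DD_uu l hl (DD_schwartz _)) (by norm_num)
    have a2 : Integrable (fun x => uu l x * Lap (psi φ) x) :=
      DD_int (DD_uu l hl (DD_schwartz _)) (by norm_num)
    rw [← int_uLap_psi l hl φ, ← integral_const_mul, ← integral_add (a1.const_mul 8) a2, Lap_mr,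
      Lap_add, Lap_smul]
    refine integral_congr_ae (Filter.Eventually.of_forall fun x => ?_)
    simp only [_root_.add_apply, _root_.smul_apply, smul_eq_mul]
    ring
  simp only [hmr, lapl4_eq, hu, h0, hI, true_and]
  ring

end
end

section
/- Let k ≥ 0 be an integer and l > 0. For every Schwartz function φ on ℝ one has ∫_0^∞ r^{−k−1} ( φ(r) − Σ_{j=0}^{k−1} φ^{(j)}(0) r^j/j! − θ(l−r) φ^{(k)}(0) r^k/k! ) dr = −(1/k!) ∫_0^∞ log(r/l) φ^{(k+1)}(r) dr + (H_k/k!) φ^{(k)}(0), where θ is the Heaviside step function and H_k is the k-th harmonic number; both integrals are absolutely convergent. (This is the extension formula R_1[r^{−k−1}] = ((−1)^k/k!)[ (log(r/l))^{(k+1)} + H_k δ^{(k)}(r) ] on the half-line.) -/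
open MeasureTheory Real SchwartzMap

noncomputable section

def Tp (φ : SchwartzMap ℝ ℝ) (n : ℕ) (r : ℝ) : ℝ :=
  ∑ j ∈ Finset.range n, iteratedDeriv j (⇑φ) 0 * r ^ j / (j.factorial : ℝ)

def Dd (φ : SchwartzMap ℝ ℝ) : SchwartzMap ℝ ℝ := SchwartzMap.derivCLM ℝ ℝ φ

def Fk (k : ℕ) (l : ℝ) (φ : SchwartzMap ℝ ℝ) (r : ℝ) : ℝ :=
  (r ^ (k + 1))⁻¹ * (φ r - Tp φ k r
    - (if r ≤ l then (1 : ℝ) else 0) * iteratedDeriv k (⇑φ) 0 * r ^ k / (k.factorial : ℝ))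

lemma coe_Dd (φ : SchwartzMap ℝ ℝ) : ⇑(Dd φ) = deriv φ := by
  funext x; exact SchwartzMap.derivCLM_apply ℝ φ x

lemma iter_Dd (φ : SchwartzMap ℝ ℝ) (n : ℕ) :
    iteratedDeriv n (⇑(Dd φ)) = iteratedDeriv (n + 1) (⇑φ) := by
  rw [coe_Dd, iteratedDeriv_succ']

lemma hasDerivAt_phi (φ : SchwartzMap ℝ ℝ) (x : ℝ) : HasDerivAt φ (Dd φ x) x := by
  rw [coe_Dd]; exact φ.hasDerivAt x

lemma hasDerivAt_Tp (φ : SchwartzMap ℝ ℝ) (n : ℕ) (r : ℝ) :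
    HasDerivAt (Tp φ (n + 1)) (Tp (Dd φ) n r) r := by
  have h : Tp φ (n + 1) = fun r => (∑ j ∈ Finset.range n,
      iteratedDeriv (j + 1) (⇑φ) 0 * r ^ (j + 1) / ((j + 1).factorial : ℝ)) + φ 0 := by
    funext r; simp [Tp, Finset.sum_range_succ']
  rw [h]
  refine HasDerivAt.add_const _ ?_
  unfold Tp
  refine HasDerivAt.fun_sum fun j _ => ?_
  rw [iter_Dd]
  have := ((hasDerivAt_pow (j + 1) r).const_mul (iteratedDeriv (j + 1) (⇑φ) 0)).div_const
    ((j + 1).factorial : ℝ)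
  convert! this using 1
  rw [Nat.factorial_succ]
  push_cast
  have : (j.factorial : ℝ) ≠ 0 := by positivity
  have : (j : ℝ) + 1 ≠ 0 := by positivity
  field_simp

lemma Tp_zero (φ : SchwartzMap ℝ ℝ) (n : ℕ) : Tp φ (n + 1) 0 = φ 0 := by
  simp [Tp, Finset.sum_range_succ']

lemma Tp_continuous (φ : SchwartzMap ℝ ℝ) (n : ℕ) : Continuous (Tp φ n) := by
  unfold Tp; fun_prop

lemma phi_bound (φ : SchwartzMap ℝ ℝ) : ∃ C, 0 ≤ C ∧ ∀ r, |φ r| ≤ C :=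
  ⟨SchwartzMap.seminorm ℝ 0 0 φ, apply_nonneg _ _, fun r => φ.norm_le_seminorm ℝ r⟩

lemma taylor (n : ℕ) : ∀ φ : SchwartzMap ℝ ℝ, ∃ C, 0 ≤ C ∧ ∀ r, 0 ≤ r →
    |φ r - Tp φ n r| ≤ C * r ^ n := by
  induction n with
  | zero =>
    intro φ
    obtain ⟨C, h0, h⟩ := phi_bound φ
    exact ⟨C, h0, fun r _ => by simpa [Tp] using h r⟩
  | succ n ih =>
    intro φ
    obtain ⟨C, h0, h⟩ := ih (Dd φ)
    refine ⟨C, h0, fun r hr => ?_⟩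
    have := norm_image_sub_le_of_norm_deriv_le_segment' (a := 0) (b := r) (C := C * r ^ n)
      (f := fun x => φ x - Tp φ (n + 1) x) (f' := fun x => Dd φ x - Tp (Dd φ) n x)
      (fun x _ => ((hasDerivAt_phi φ x).sub (hasDerivAt_Tp φ n x)).hasDerivWithinAt)
      (fun x hx => (h x hx.1).trans (by have := hx.1; have := hx.2.le; gcongr)) r ⟨hr, le_rfl⟩
    simp only [Tp_zero, sub_self, sub_zero, Real.norm_eq_abs] at this
    rw [pow_succ, ← mul_assoc]
    exact this

lemma Fk_le (k : ℕ) (l : ℝ) (φ : SchwartzMap ℝ ℝ) {r : ℝ} (h : r ≤ l) :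
    Fk k l φ r = (r ^ (k + 1))⁻¹ * (φ r - Tp φ (k + 1) r) := by
  simp only [Fk, h, if_true, Tp, Finset.sum_range_succ, one_mul]; ring

lemma Fk_gt (k : ℕ) (l : ℝ) (φ : SchwartzMap ℝ ℝ) {r : ℝ} (h : l < r) :
    Fk k l φ r = (r ^ (k + 1))⁻¹ * (φ r - Tp φ k r) := by
  simp [Fk, not_le.2 h]

lemma inv_pow_meas (k : ℕ) : Measurable (fun r : ℝ => (r ^ (k + 1))⁻¹) := by fun_prop

lemma Fk_int1 (k : ℕ) (l : ℝ) (φ : SchwartzMap ℝ ℝ) :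
    IntegrableOn (Fk k l φ) (Set.Ioc 0 l) := by
  obtain ⟨C, h0, h⟩ := taylor (k + 1) φ
  have hm : IntegrableOn (fun r => (r ^ (k + 1))⁻¹ * (φ r - Tp φ (k + 1) r)) (Set.Ioc 0 l) := by
    refine Measure.integrableOn_of_bounded (M := C) (by simp) ?_ ?_
    · exact ((inv_pow_meas k).mul
        (φ.continuous.sub (Tp_continuous φ (k + 1))).measurable).aestronglyMeasurable
    · refine (ae_restrict_iff' measurableSet_Ioc).2 (.of_forall fun r hr => ?_)
      have hr0 : 0 < r := hr.1
      rw [Real.norm_eq_abs, abs_mul, abs_of_pos (by positivity : 0 < (r ^ (k + 1))⁻¹),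
        inv_mul_le_iff₀ (by positivity), mul_comm]
      exact h r hr0.le
  exact hm.congr_fun (fun r hr => (Fk_le k l φ hr.2).symm) measurableSet_Ioc

lemma Fk_int2 (k : ℕ) (l : ℝ) (hl : 0 < l) (φ : SchwartzMap ℝ ℝ) :
    IntegrableOn (Fk k l φ) (Set.Ioi l) := by
  have h1 : IntegrableOn (fun r => (r ^ (k + 1))⁻¹ * φ r) (Set.Ioi l) := by
    refine Integrable.bdd_mul (c := (l ^ (k + 1))⁻¹) φ.integrable.integrableOn
      (inv_pow_meas k).aestronglyMeasurable ?_
    refine (ae_restrict_iff' measurableSet_Ioi).2 (.of_forall fun r hr => ?_)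
    have hr1 : l < r := hr
    have hr0 : 0 < r := hl.trans hr
    rw [Real.norm_eq_abs, abs_of_pos (by positivity : 0 < (r ^ (k + 1))⁻¹)]
    gcongr
  have h2 : IntegrableOn (fun r => ∑ j ∈ Finset.range k,
      iteratedDeriv j (⇑φ) 0 / (j.factorial : ℝ) * r ^ ((j : ℝ) - k - 1)) (Set.Ioi l) := by
    refine integrable_finsetSum _ fun j hj => ?_
    refine Integrable.const_mul ?_ _
    refine integrableOn_Ioi_rpow_of_lt ?_ hl
    have : (j : ℝ) < k := by exact_mod_cast Finset.mem_range.1 hj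
    linarith
  refine (h1.sub h2).congr_fun (fun r hr => ?_) measurableSet_Ioi
  have hr0 : 0 < r := hl.trans hr
  rw [Fk_gt k l φ hr, mul_sub]
  simp only [Pi.sub_apply, Tp, Finset.mul_sum]
  congr 1
  refine Finset.sum_congr rfl fun j _ => ?_
  rw [sub_sub, Real.rpow_sub hr0, Real.rpow_natCast]
  have : r ^ ((k : ℝ) + 1) = r ^ (k + 1) := by exact_mod_cast Real.rpow_natCast r (k + 1)
  rw [this]; ring

lemma Ioi_split (l : ℝ) (hl : 0 < l) : Set.Ioi (0 : ℝ) = Set.Ioc 0 l ∪ Set.Ioi l :=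
  (Set.Ioc_union_Ioi_eq_Ioi hl.le).symm

lemma Fk_int (k : ℕ) (l : ℝ) (hl : 0 < l) (φ : SchwartzMap ℝ ℝ) :
    IntegrableOn (Fk k l φ) (Set.Ioi 0) := by
  rw [Ioi_split l hl]
  exact (Fk_int1 k l φ).union (Fk_int2 k l hl φ)

lemma log_int1 (l : ℝ) (hl : 0 < l) (φ : SchwartzMap ℝ ℝ) :
    IntegrableOn (fun r => Real.log (r / l) * φ r) (Set.Ioc 0 l) := by
  obtain ⟨C, h0, h⟩ := phi_bound φ
  have h1 : IntegrableOn (fun r => Real.log r - Real.log l) (Set.Ioc 0 l) :=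
    ((intervalIntegral.intervalIntegrable_log' (a := 0) (b := l)).1).sub (by simp)
  refine Integrable.mul_bdd (c := C) ?_ φ.continuous.aestronglyMeasurable (.of_forall h)
  refine h1.congr_fun (fun r hr => ?_) measurableSet_Ioc
  exact (Real.log_div hr.1.ne' hl.ne').symm

lemma log_le_div (l : ℝ) (hl : 0 < l) (r : ℝ) (hr : l < r) :
    |Real.log (r / l)| ≤ r / l := by
  have : 1 < r / l := by rwa [one_lt_div hl]
  rw [abs_of_nonneg (Real.log_nonneg this.le)]
  exact (Real.log_le_sub_one_of_pos (by linarith)).trans (by linarith)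

lemma log_int2 (l : ℝ) (hl : 0 < l) (φ : SchwartzMap ℝ ℝ) :
    IntegrableOn (fun r => Real.log (r / l) * φ r) (Set.Ioi l) := by
  have h := ((φ.integrable_pow_mul volume 1).const_mul l⁻¹).integrableOn (s := Set.Ioi l)
  refine Integrable.mono h ?_ ?_
  · exact ((Real.measurable_log.comp (measurable_id.div_const l)).mul
      φ.continuous.measurable).aestronglyMeasurable
  · refine (ae_restrict_iff' measurableSet_Ioi).2 (.of_forall fun r hr => ?_)
    have hr0 : 0 < r := hl.trans hr
    have := log_le_div l hl r hr
    simp only [Real.norm_eq_abs, abs_mul, abs_abs, pow_one, abs_inv, abs_of_pos hl]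
    rw [← mul_assoc, abs_of_pos hr0, inv_mul_eq_div]
    gcongr

lemma log_int (l : ℝ) (hl : 0 < l) (φ : SchwartzMap ℝ ℝ) :
    IntegrableOn (fun r => Real.log (r / l) * φ r) (Set.Ioi 0) := by
  rw [Ioi_split l hl]
  exact (log_int1 l hl φ).union (log_int2 l hl φ)

lemma hasDerivAt_log_div (l : ℝ) (hl : 0 < l) (r : ℝ) (hr : 0 < r) :
    HasDerivAt (fun r => Real.log (r / l)) r⁻¹ r := by
  have := (Real.hasDerivAt_log (by positivity : r / l ≠ 0)).comp r
    ((hasDerivAt_id r).div_const l)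
  convert! this using 1
  field_simp

open Filter Topology

lemma phi_tendsto (φ : SchwartzMap ℝ ℝ) : Tendsto φ atTop (𝓝 0) :=
  φ.tendsto_cocompact.mono_left atTop_le_cocompact

lemma base (l : ℝ) (hl : 0 < l) (φ : SchwartzMap ℝ ℝ) :
    ∫ r in Set.Ioi 0, Fk 0 l φ r = - ∫ r in Set.Ioi 0, Real.log (r / l) * Dd φ r := by
  have hlog : ∀ r, 0 < r → ContinuousAt (fun r => Real.log (r / l)) r :=
    fun r hr => (hasDerivAt_log_div l hl r hr).continuousAt
  have hA : ∫ r in Set.Ioi l, (Fk 0 l φ r + Real.log (r / l) * Dd φ r) = 0 := by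
    have := integral_Ioi_of_hasDerivAt_of_tendsto (a := l) (m := 0)
      (f := fun r => Real.log (r / l) * φ r)
      (f' := fun r => Fk 0 l φ r + Real.log (r / l) * Dd φ r) ?_ ?_
      ((Fk_int2 0 l hl φ).add (log_int2 l hl (Dd φ))) ?_
    · simpa [hl.ne'] using this
    · exact ((hlog l hl).mul φ.continuous.continuousAt).continuousWithinAt
    · intro r hr
      have hr0 : 0 < r := hl.trans hr
      rw [Fk_gt 0 l φ hr]
      convert! (hasDerivAt_log_div l hl r hr0).mul (hasDerivAt_phi φ r) using 1
      simp [Tp]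
    · obtain ⟨C, hC, h⟩ := φ.decay 2 0
      have h0 : Tendsto (fun r : ℝ => (C / l) * r⁻¹) atTop (𝓝 0) := by
        simpa using tendsto_inv_atTop_zero.const_mul (C / l)
      refine squeeze_zero_norm' ?_ h0
      filter_upwards [eventually_gt_atTop l] with r hr
      have hr0 : 0 < r := hl.trans hr
      have h1 := log_le_div l hl r hr
      have h2 := h r
      rw [norm_iteratedFDeriv_zero, Real.norm_eq_abs, Real.norm_eq_abs, abs_of_pos hr0] at h2
      rw [Real.norm_eq_abs, abs_mul]
      calc |Real.log (r / l)| * |φ r| ≤ r / l * |φ r| := by gcongr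
        _ = (r ^ 2 * |φ r|) / l * r⁻¹ := by field_simp
        _ ≤ C / l * r⁻¹ := by gcongr
  have hB : ∫ r in Set.Ioc 0 l, (Fk 0 l φ r + Real.log (r / l) * Dd φ r) = 0 := by
    rw [← intervalIntegral.integral_of_le hl.le]
    rw [intervalIntegral.integral_eq_sub_of_hasDerivAt_of_tendsto
      (f := fun r => Real.log (r / l) * (φ r - φ 0)) (fa := 0) (fb := 0) hl, sub_zero]
    · intro r hr
      rw [Fk_le 0 l φ hr.2.le]
      convert! (hasDerivAt_log_div l hl r hr.1).mul ((hasDerivAt_phi φ r).sub_const (φ 0)) using 1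
      simp [Tp]
    · rw [intervalIntegrable_iff_integrableOn_Ioc_of_le hl.le]
      exact (Fk_int1 0 l φ).add (log_int1 l hl (Dd φ))
    · obtain ⟨C, hC, h⟩ := taylor 1 φ
      have h0 : Tendsto (fun r : ℝ => C * |Real.log r * r ^ (1:ℝ) - Real.log l * r|)
          (𝓝[>] 0) (𝓝 0) := by
        have h1 := tendsto_log_mul_rpow_nhdsGT_zero (r := 1) one_pos
        have h2 : Tendsto (fun r : ℝ => Real.log l * r) (𝓝[>] 0) (𝓝 (Real.log l * 0)) :=
          ((continuous_const.mul continuous_id).tendsto 0).mono_left nhdsWithin_le_nhds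
        simpa using (h1.sub h2).abs.const_mul C
      refine squeeze_zero_norm' ?_ h0
      filter_upwards [self_mem_nhdsWithin] with r hr
      have hr0 : (0:ℝ) < r := hr
      have h1 := h r hr0.le
      simp only [Tp, Finset.range_one, Finset.sum_singleton, iteratedDeriv_zero, pow_zero, mul_one,
        Nat.factorial_zero, Nat.cast_one, div_one, pow_one] at h1
      rw [Real.norm_eq_abs, abs_mul, Real.rpow_one, ← sub_mul,
        ← Real.log_div hr0.ne' hl.ne', abs_mul, abs_of_pos hr0]
      calc _ ≤ |Real.log (r / l)| * (C * r) := by gcongr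
        _ = _ := by ring
    · have : ContinuousAt (fun r => Real.log (r / l) * (φ r - φ 0)) l :=
        (hlog l hl).mul (φ.continuous.continuousAt.sub continuousAt_const)
      have h2 := this.tendsto.mono_left (nhdsWithin_le_nhds (s := Set.Iio l))
      simpa [hl.ne'] using h2
  have hF := Fk_int 0 l hl φ
  have hL := log_int l hl (Dd φ)
  rw [eq_neg_iff_add_eq_zero, ← integral_add hF hL, Ioi_split l hl,
    setIntegral_union (Set.Ioc_disjoint_Ioi le_rfl) measurableSet_Ioi, hA, hB, add_zero]
  · exact (Fk_int1 0 l φ).add (log_int1 l hl (Dd φ))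
  · exact (Fk_int2 0 l hl φ).add (log_int2 l hl (Dd φ))

lemma step (k : ℕ) (l : ℝ) (hl : 0 < l) (φ : SchwartzMap ℝ ℝ) :
    (∫ r in Set.Ioi 0, Fk k l (Dd φ) r) - ((k : ℝ) + 1) * ∫ r in Set.Ioi 0, Fk (k + 1) l φ r
      = - (iteratedDeriv (k + 1) (⇑φ) 0 / ((k + 1).factorial : ℝ)) := by
  set c : ℝ := iteratedDeriv (k + 1) (⇑φ) 0 / ((k + 1).factorial : ℝ) with hc
  set G : ℝ → ℝ := fun r => (r ^ (k + 1))⁻¹ * (φ r - Tp φ (k + 1) r) with hG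
  have hI1 := Fk_int k l hl (Dd φ)
  have hI2 := (Fk_int (k + 1) l hl φ).const_mul ((k : ℝ) + 1)
  rw [← integral_const_mul, ← integral_sub hI1 hI2]
  have := integral_Ioi_of_hasDerivAt_of_tendsto (a := 0) (m := 0)
      (f := Function.update G 0 c)
      (f' := fun r => Fk k l (Dd φ) r - ((k : ℝ) + 1) * Fk (k + 1) l φ r) ?_ ?_
      (hI1.sub hI2) ?_
  · simpa using this
  · rw [← continuousWithinAt_Ioi_iff_Ici, continuousWithinAt_update_same]
    obtain ⟨C, hC, h⟩ := taylor (k + 2) φ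
    have h0 : Tendsto (fun r : ℝ => C * r) (𝓝[>] 0) (𝓝 0) := by
      have : Tendsto (fun r : ℝ => C * r) (𝓝[>] 0) (𝓝 (C * 0)) :=
        ((continuous_const.mul continuous_id).tendsto 0).mono_left nhdsWithin_le_nhds
      simpa using this
    rw [show Set.Ioi (0:ℝ) \ {0} = Set.Ioi 0 by simp, tendsto_iff_norm_sub_tendsto_zero]
    refine squeeze_zero' (.of_forall fun _ => norm_nonneg _) ?_ h0
    filter_upwards [self_mem_nhdsWithin] with r hr
    have hr0 : (0:ℝ) < r := hr
    have h1 := h r hr0.le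
    have h2 : G r - c = (r ^ (k + 1))⁻¹ * (φ r - Tp φ (k + 2) r) := by
      simp only [hG, hc, Tp, Finset.sum_range_succ _ (k + 1)]
      field_simp
      ring
    rw [h2, Real.norm_eq_abs, abs_mul, abs_of_pos (by positivity : 0 < (r ^ (k + 1))⁻¹),
      inv_mul_le_iff₀ (by positivity)]
    exact h1.trans_eq (by ring)
  · intro r hr
    have hr0 : (0:ℝ) < r := hr
    have h1 : HasDerivAt G (Fk k l (Dd φ) r - ((k : ℝ) + 1) * Fk (k + 1) l φ r) r := by
      have := ((hasDerivAt_pow (k + 1) r).inv (by positivity)).mul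
        ((hasDerivAt_phi φ r).sub (hasDerivAt_Tp φ k r))
      convert! this using 1
      simp only [Fk, iter_Dd, Nat.factorial_succ, Nat.cast_mul, Nat.cast_add, Nat.cast_one,
        Pi.sub_apply, Pi.inv_apply, Pi.pow_apply, Nat.add_sub_cancel]
      have : (k.factorial : ℝ) ≠ 0 := by positivity
      have : (k : ℝ) + 1 ≠ 0 := by positivity
      field_simp
      ring
    refine h1.congr_of_eventuallyEq ?_
    filter_upwards [eventually_ne_nhds hr0.ne'] with x hx
    simp [hx]
  · have h1 : Tendsto G atTop (𝓝 0) := by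
      have hp : ∀ m : ℕ, Tendsto (fun r : ℝ => (r ^ (m + 1))⁻¹) atTop (𝓝 0) := fun m =>
        tendsto_inv_atTop_zero.comp (tendsto_pow_atTop (by simp))
      have h2 := (hp k).mul (phi_tendsto φ)
      have h3 : Tendsto (fun r : ℝ => ∑ j ∈ Finset.range (k + 1),
          iteratedDeriv j (⇑φ) 0 / (j.factorial : ℝ) * (r ^ (k - j + 1))⁻¹) atTop
          (𝓝 (∑ j ∈ Finset.range (k + 1), iteratedDeriv j (⇑φ) 0 / (j.factorial : ℝ) * 0)) :=
        tendsto_finsetSum _ fun j _ => (hp (k - j)).const_mul _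
      have h4 := h2.sub h3
      simp only [mul_zero, Finset.sum_const_zero, sub_zero] at h4
      refine h4.congr' ?_
      filter_upwards [eventually_gt_atTop 0] with r hr0
      simp only [hG, Tp, mul_sub, Finset.mul_sum]
      congr 1
      refine Finset.sum_congr rfl fun j hj => ?_
      have hj : j ≤ k := by simpa [Nat.lt_succ_iff] using hj
      have : r ^ (k + 1) = r ^ (k - j + 1) * r ^ j := by
        rw [← pow_add]; congr 1; omega
      rw [this]
      field_simp
    refine h1.congr' ?_
    filter_upwards [eventually_gt_atTop 0] with x hx
    simp [hx.ne']

lemma main (l : ℝ) (hl : 0 < l) (k : ℕ) : ∀ φ : SchwartzMap ℝ ℝ,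
    ∫ r in Set.Ioi 0, Fk k l φ r =
      -(1 / (k.factorial : ℝ)) *
            (∫ r in Set.Ioi (0 : ℝ), Real.log (r / l) * iteratedDeriv (k + 1) (⇑φ) r)
        + ((∑ j ∈ Finset.Icc 1 k, (1 : ℝ) / (j : ℝ)) / (k.factorial : ℝ)) *
            iteratedDeriv k (⇑φ) 0 := by
  induction k with
  | zero => intro φ; rw [base l hl]; simp [coe_Dd, iteratedDeriv_one]
  | succ k ih =>
    intro φ
    have h := step k l hl φ
    rw [ih (Dd φ), iter_Dd, iter_Dd] at h
    rw [Finset.sum_Icc_succ_top (by omega)]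
    rw [Nat.factorial_succ] at *
    push_cast at *
    have h1 : (k.factorial : ℝ) ≠ 0 := by positivity
    have h2 : (k : ℝ) + 1 ≠ 0 := by positivity
    refine mul_left_cancel₀ h2 ?_
    rw [sub_eq_iff_eq_add, ← sub_eq_iff_eq_add'] at h
    rw [← h]
    field_simp
    ring

lemma iter_schwartz (n : ℕ) : ∀ φ : SchwartzMap ℝ ℝ, ∃ ψ : SchwartzMap ℝ ℝ,
    ⇑ψ = iteratedDeriv n (⇑φ) := by
  induction n with
  | zero => exact fun φ => ⟨φ, by simp⟩
  | succ n ih =>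
    intro φ
    obtain ⟨ψ, h⟩ := ih (Dd φ)
    exact ⟨ψ, by rw [h, iter_Dd]⟩

/-- the extension formula on the half-line:
`R_1[r^{-k-1}] = ((-1)^k/k!)[(log(r/l))^{(k+1)} + H_k δ^{(k)}(r)]`, i.e. for every
Schwartz function `φ` on `ℝ`,
`∫_0^∞ r^{-k-1}(φ(r) - Σ_{j<k} φ^{(j)}(0) r^j/j! - θ(l-r) φ^{(k)}(0) r^k/k!) dr
  = -(1/k!) ∫_0^∞ log(r/l) φ^{(k+1)}(r) dr + (H_k/k!) φ^{(k)}(0)`;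
both integrals are absolutely convergent. -/
theorem stmt_9 (k : ℕ) (l : ℝ) (hl : 0 < l) (φ : SchwartzMap ℝ ℝ) :
    IntegrableOn (fun r : ℝ =>
        r ^ (-(k : ℝ) - 1) *
          (φ r - (∑ j ∈ Finset.range k, iteratedDeriv j (⇑φ) 0 * r ^ j / (j.factorial : ℝ))
            - (if r ≤ l then (1 : ℝ) else 0) * iteratedDeriv k (⇑φ) 0 * r ^ k /
                (k.factorial : ℝ))) (Set.Ioi 0) ∧
    IntegrableOn (fun r : ℝ => Real.log (r / l) * iteratedDeriv (k + 1) (⇑φ) r)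
      (Set.Ioi 0) ∧
    (∫ r in Set.Ioi (0 : ℝ),
        r ^ (-(k : ℝ) - 1) *
          (φ r - (∑ j ∈ Finset.range k, iteratedDeriv j (⇑φ) 0 * r ^ j / (j.factorial : ℝ))
            - (if r ≤ l then (1 : ℝ) else 0) * iteratedDeriv k (⇑φ) 0 * r ^ k /
                (k.factorial : ℝ)))
      = -(1 / (k.factorial : ℝ)) *
            (∫ r in Set.Ioi (0 : ℝ), Real.log (r / l) * iteratedDeriv (k + 1) (⇑φ) r)
        + ((∑ j ∈ Finset.Icc 1 k, (1 : ℝ) / (j : ℝ)) / (k.factorial : ℝ)) *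
            iteratedDeriv k (⇑φ) 0 := by
  have hE : Set.EqOn (Fk k l φ) (fun r : ℝ =>
        r ^ (-(k : ℝ) - 1) *
          (φ r - (∑ j ∈ Finset.range k, iteratedDeriv j (⇑φ) 0 * r ^ j / (j.factorial : ℝ))
            - (if r ≤ l then (1 : ℝ) else 0) * iteratedDeriv k (⇑φ) 0 * r ^ k /
                (k.factorial : ℝ))) (Set.Ioi 0) := by
    intro r hr
    have hr0 : (0 : ℝ) < r := hr
    have : r ^ (-(k : ℝ) - 1) = (r ^ (k + 1))⁻¹ := by
      rw [← neg_add', Real.rpow_neg hr0.le]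
      congr 1
      exact_mod_cast Real.rpow_natCast r (k + 1)
    simp only [Fk, Tp, this]
  obtain ⟨ψ, hψ⟩ := iter_schwartz (k + 1) φ
  refine ⟨(Fk_int k l hl φ).congr_fun hE measurableSet_Ioi, ?_, ?_⟩
  · rw [← hψ]
    exact log_int l hl ψ
  · rw [← setIntegral_congr_fun measurableSet_Ioi hE]
    exact main l hl k φ

end
end
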